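/- Let m ≥ 3 and let S be the subdivision graph of the complete bipartite graph K_{m,m}. Then for every edge f = xy of S, where x is an original vertex of K_{m,m} and y is a subdivision vertex, m_x(f) = m² − 1 and m_y(f) = 2m − 1. -/

import Mathlib

open SimpleGraph


/-- Distance from a vertex to an edge (unordered pair): min of distances to the endpoints. -/
noncomputable def evdist {V : Type*} (G : SimpleGraph V) (g : V) (e : Sym2 V) : ℕ :=
  Sym2.lift ⟨fun u v => min (G.dist g u) (G.dist g v), fun _ _ => min_comm _ _⟩ e

/-- `mcount G g h` is the number of edges of `G` strictly closer to `g` than to `h`. -/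
noncomputable def mcount {V : Type*} (G : SimpleGraph V) (g h : V) : ℕ :=
  {e ∈ G.edgeSet | evdist G g e < evdist G h e}.ncard

/-- `m0count G g h` is the number of edges of `G`, other than `s(g,h)` itself, that are
equidistant from `g` and from `h`. -/
noncomputable def m0count {V : Type*} (G : SimpleGraph V) (g h : V) : ℕ :=
  {e ∈ G.edgeSet | e ≠ s(g, h) ∧ evdist G g e = evdist G h e}.ncard

/-- `ncount G g h` is the number of vertices of `G` strictly closer to `g` than to `h`. -/
noncomputable def ncount {V : Type*} (G : SimpleGraph V) (g h : V) : ℕ :=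
  {w : V | G.dist w g < G.dist w h}.ncard

/-- Edge quasi-λ-distance-balanced. -/
def IsEQDB {V : Type*} (G : SimpleGraph V) (lam : ℚ) : Prop :=
  ∀ g h : V, G.Adj g h →
    (mcount G g h : ℚ) = lam * mcount G h g ∨ (mcount G h g : ℚ) = lam * mcount G g h

/-- Quasi-λ-distance-balanced. -/
def IsQDB {V : Type*} (G : SimpleGraph V) (lam : ℚ) : Prop :=
  ∀ g h : V, G.Adj g h →
    (ncount G g h : ℚ) = lam * ncount G h g ∨ (ncount G h g : ℚ) = lam * ncount G g h


/-- The subdivision graph `S(G)`: vertices are `V(G) ⊕ E(G)`, with an original vertex adjacent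
to a subdivision vertex iff it is an endpoint of the corresponding edge. -/
def subdivision {V : Type*} (G : SimpleGraph V) : SimpleGraph (V ⊕ G.edgeSet) where
  Adj x y :=
    match x, y with
    | Sum.inl v, Sum.inr e => v ∈ (e : Sym2 V)
    | Sum.inr e, Sum.inl v => v ∈ (e : Sym2 V)
    | _, _ => False
  symm := ⟨by rintro (v | e) (w | f) h <;> exact h⟩
  loopless := ⟨by rintro (v | e) h <;> exact h⟩

/-- A function that vanishes exactly at `g`, grows by at most one along edges, and can always be
decreased along an edge away from `g`, is the distance from `g`. -/
lemma SimpleGraph.dist_eq_of_descent {V : Type*} {G : SimpleGraph V} {g : V} (f : V → ℕ)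
    (hg : ∀ v, f v = 0 ↔ v = g) (hlip : ∀ u v, G.Adj u v → f v ≤ f u + 1)
    (hdesc : ∀ v, f v ≠ 0 → ∃ u, G.Adj u v ∧ f v = f u + 1) (v : V) :
    G.dist g v = f v := by
  have hwalk : ∀ n v, f v = n → ∃ p : G.Walk g v, p.length = n := by
    intro n
    induction n with
    | zero => intro v hv; obtain rfl := (hg v).1 hv; exact ⟨.nil, rfl⟩
    | succ n ih =>
      intro v hv
      obtain ⟨u, huv, hu⟩ := hdesc v (by omega)
      obtain ⟨p, hp⟩ := ih u (by omega)
      exact ⟨p.concat huv, by simp [hp]⟩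
  have hle : ∀ {u v : V} (p : G.Walk u v), f v ≤ f u + p.length := by
    intro u v p
    induction p with
    | nil => simp
    | cons h p ih => have := hlip _ _ h; rw [Walk.length_cons]; omega
  obtain ⟨p, hp⟩ := hwalk _ v rfl
  apply le_antisymm (hp ▸ dist_le p)
  obtain ⟨q, hq⟩ := p.reachable.exists_walk_length_eq_dist
  have := hle q
  rw [(hg g).2 rfl] at this
  omega

lemma dist_map_iso {V W : Type*} {G : SimpleGraph V} {H : SimpleGraph W} (φ : G ≃g H) (u v : V) :
    H.dist (φ u) (φ v) = G.dist u v := by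
  simp only [dist_eq_sInf]
  congr 1
  ext n
  constructor
  · rintro ⟨p, rfl⟩
    exact ⟨(p.map φ.symm.toHom).copy (by simp) (by simp), by simp⟩
  · rintro ⟨p, rfl⟩
    exact ⟨p.map φ.toHom, by simp⟩

lemma evdist_mk {V : Type*} (G : SimpleGraph V) (g u v : V) :
    evdist G g s(u, v) = min (G.dist g u) (G.dist g v) := rfl

lemma mcount_map_iso {V W : Type*} {G : SimpleGraph V} {H : SimpleGraph W} (φ : G ≃g H)
    (g h : V) : mcount H (φ g) (φ h) = mcount G g h := by
  unfold mcount
  rw [← Set.ncard_image_of_injective _ (Sym2.map.injective φ.injective)]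
  congr 1
  ext e
  induction e with | _ u v
  obtain ⟨u, rfl⟩ := φ.surjective u
  obtain ⟨v, rfl⟩ := φ.surjective v
  rw [← Sym2.map_mk, (Sym2.map.injective φ.injective).mem_set_image]
  simp only [Set.mem_ofPred_eq, Sym2.map_mk, mem_edgeSet, evdist_mk, dist_map_iso, φ.map_adj_iff]

section

variable (α β : Type*)

/-- The subdivision of `K_{α,β}`, with the edges of `K_{α,β}` labelled by `α × β`. -/
def bipartiteSubdivision : SimpleGraph ((α ⊕ β) ⊕ (α × β)) where
  Adj x y :=
    match x, y with
    | .inl (.inl a), .inr p => a = p.1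
    | .inl (.inr b), .inr p => b = p.2
    | .inr p, .inl (.inl a) => a = p.1
    | .inr p, .inl (.inr b) => b = p.2
    | _, _ => False
  symm := ⟨by rintro ((a | b) | p) ((c | d) | q) h <;> exact h⟩
  loopless := ⟨by rintro ((a | b) | p) h <;> exact h⟩

/-- The edges of `K_{α,β}` are the pairs in `α × β`. -/
noncomputable def prodEquivEdgeSet : α × β ≃ (completeBipartiteGraph α β).edgeSet :=
  Equiv.ofBijective (fun p => ⟨s(.inl p.1, .inr p.2), by simp⟩) <| by
    constructor
    · rintro ⟨a, b⟩ ⟨c, d⟩ h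
      simpa using h
    · rintro ⟨e, he⟩
      induction e with | _ u v
      rcases u with a | b <;> rcases v with c | d <;> simp at he
      · exact ⟨(a, d), rfl⟩
      · exact ⟨(c, b), Subtype.ext Sym2.eq_swap⟩

lemma coe_prodEquivEdgeSet (p : α × β) :
    (prodEquivEdgeSet α β p : Sym2 (α ⊕ β)) = s(.inl p.1, .inr p.2) := rfl

/-- `bipartiteSubdivision α β` is the subdivision of `K_{α,β}`. -/
noncomputable def bipartiteSubdivisionIso :
    bipartiteSubdivision α β ≃g subdivision (completeBipartiteGraph α β) where
  toEquiv := Equiv.sumCongr (Equiv.refl _) (prodEquivEdgeSet α β)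
  map_rel_iff' := by
    rintro ((a | b) | p) ((c | d) | q) <;>
      simp [bipartiteSubdivision, subdivision, coe_prodEquivEdgeSet]

/-- Exchanging the two sides of `K_{α,β}`. -/
def bipartiteSubdivisionSwap : bipartiteSubdivision α β ≃g bipartiteSubdivision β α where
  toEquiv := Equiv.sumCongr (Equiv.sumComm α β) (Equiv.prodComm α β)
  map_rel_iff' := by
    rintro ((a | b) | p) ((c | d) | q) <;> simp [bipartiteSubdivision]

variable {α β}

/-- The edge of `bipartiteSubdivision α β` joining `p` to its end in `α` or in `β`. -/
def halfEdge : (α × β) ⊕ (α × β) → Sym2 ((α ⊕ β) ⊕ (α × β))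
  | .inl p => s(.inl (.inl p.1), .inr p)
  | .inr p => s(.inl (.inr p.2), .inr p)

lemma halfEdge_injective : Function.Injective (halfEdge (α := α) (β := β)) := by
  rintro (p | p) (q | q) h <;> simp_all [halfEdge]

lemma range_halfEdge :
    Set.range (halfEdge (α := α) (β := β)) = (bipartiteSubdivision α β).edgeSet := by
  ext e
  constructor
  · rintro ⟨p | p, rfl⟩ <;> simp [halfEdge, bipartiteSubdivision]
  · intro he
    induction e with | _ u v
    rcases u with (a | b) | p <;> rcases v with (c | d) | q <;>
      simp only [bipartiteSubdivision, mem_edgeSet] at he <;> subst he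
    · exact ⟨.inl q, rfl⟩
    · exact ⟨.inr q, rfl⟩
    · exact ⟨.inl p, Sym2.eq_swap⟩
    · exact ⟨.inr p, Sym2.eq_swap⟩

lemma mcount_bipartiteSubdivision (g h : (α ⊕ β) ⊕ (α × β)) :
    mcount (bipartiteSubdivision α β) g h =
      {p | evdist (bipartiteSubdivision α β) g (halfEdge p) <
        evdist (bipartiteSubdivision α β) h (halfEdge p)}.ncard := by
  rw [← Set.ncard_image_of_injective _ halfEdge_injective, mcount]
  congr 1
  ext e
  rw [Set.mem_ofPred_eq, ← range_halfEdge]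
  constructor
  · rintro ⟨⟨p, rfl⟩, hp⟩
    exact ⟨p, hp, rfl⟩
  · rintro ⟨p, hp, rfl⟩
    exact ⟨⟨p, rfl⟩, hp⟩

variable [DecidableEq α]

/-- Distance from the original vertex `a` in `bipartiteSubdivision α β`. -/
def distFromOriginal (a : α) : (α ⊕ β) ⊕ (α × β) → ℕ
  | .inl (.inl c) => if c = a then 0 else 4
  | .inl (.inr _) => 2
  | .inr q => if q.1 = a then 1 else 3

lemma dist_original (a : α) (b : β) (v : (α ⊕ β) ⊕ (α × β)) :
    (bipartiteSubdivision α β).dist (.inl (.inl a)) v = distFromOriginal a v := by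
  apply dist_eq_of_descent
  · rintro ((c | d) | q) <;> simp [distFromOriginal, ite_eq_iff]
  · rintro ((a | b) | p) ((c | d) | q) h <;> simp only [bipartiteSubdivision] at h <;> subst h <;>
      simp only [distFromOriginal] <;> split_ifs <;> omega
  · rintro ((c | d) | q) h
    · refine ⟨.inr (c, b), rfl, ?_⟩
      simp_all [distFromOriginal]
    · exact ⟨.inr (a, d), rfl, by simp [distFromOriginal]⟩
    · by_cases hq : q.1 = a
      · exact ⟨.inl (.inl q.1), rfl, by simp [distFromOriginal, hq]⟩
      · exact ⟨.inl (.inr q.2), rfl, by simp [distFromOriginal, hq]⟩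

variable [DecidableEq β]

/-- Distance from the subdivision vertex `p` in `bipartiteSubdivision α β`. -/
def distFromSubdivision (p : α × β) : (α ⊕ β) ⊕ (α × β) → ℕ
  | .inl (.inl c) => if c = p.1 then 1 else 3
  | .inl (.inr d) => if d = p.2 then 1 else 3
  | .inr q => (if q.1 = p.1 then 0 else 2) + (if q.2 = p.2 then 0 else 2)

lemma dist_subdivision (p : α × β) (v : (α ⊕ β) ⊕ (α × β)) :
    (bipartiteSubdivision α β).dist (.inr p) v = distFromSubdivision p v := by
  apply dist_eq_of_descent
  · rintro ((c | d) | q) <;> simp [distFromSubdivision, Prod.ext_iff] <;> split_ifs <;> simp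
  · rintro ((a | b) | p) ((c | d) | q) h <;> simp only [bipartiteSubdivision] at h <;> subst h <;>
      simp only [distFromSubdivision] <;> split_ifs <;> omega
  · rintro ((c | d) | q) h
    · refine ⟨.inr (c, p.2), rfl, ?_⟩
      simp only [distFromSubdivision]; split_ifs <;> simp_all
    · refine ⟨.inr (p.1, d), rfl, ?_⟩
      simp only [distFromSubdivision]; split_ifs <;> simp_all
    · by_cases hq : q.1 = p.1
      · refine ⟨.inl (.inl q.1), rfl, ?_⟩
        simp only [distFromSubdivision] at h ⊢; split_ifs at h ⊢ <;> simp_all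
      · refine ⟨.inl (.inr q.2), rfl, ?_⟩
        simp only [distFromSubdivision]; split_ifs <;> simp_all

variable [Fintype α]

lemma mcount_subdivision_original (a : α) (b : β) :
    mcount (bipartiteSubdivision α β) (.inr (a, b)) (.inl (.inl a)) =
      (Fintype.card α - 1) + Fintype.card α := by
  have hset : {p | evdist (bipartiteSubdivision α β) (.inr (a, b)) (halfEdge p) <
        evdist (bipartiteSubdivision α β) (.inl (.inl a)) (halfEdge p)} =
      ↑(({a}ᶜ ×ˢ {b} : Finset (α × β)).disjSum (Finset.univ ×ˢ {b} : Finset (α × β))) := by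
    ext (⟨c, d⟩ | ⟨c, d⟩) <;>
      by_cases h₁ : c = a <;> by_cases h₂ : d = b <;>
      simp [halfEdge, evdist_mk, dist_original a b, dist_subdivision, distFromOriginal,
        distFromSubdivision, h₁, h₂, eq_comm (a := b)]
  rw [mcount_bipartiteSubdivision, hset, Set.ncard_coe_finset]
  simp [Finset.card_compl]

variable [Fintype β]

lemma mcount_original_subdivision (a : α) (b : β) :
    mcount (bipartiteSubdivision α β) (.inl (.inl a)) (.inr (a, b)) =
      (Fintype.card α + 1) * (Fintype.card β - 1) := by
  have hset : {p | evdist (bipartiteSubdivision α β) (.inl (.inl a)) (halfEdge p) <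
        evdist (bipartiteSubdivision α β) (.inr (a, b)) (halfEdge p)} =
      ↑(({a} ×ˢ {b}ᶜ : Finset (α × β)).disjSum (Finset.univ ×ˢ {b}ᶜ : Finset (α × β))) := by
    ext (⟨c, d⟩ | ⟨c, d⟩) <;>
      by_cases h₁ : c = a <;> by_cases h₂ : d = b <;>
      simp [halfEdge, evdist_mk, dist_original a b, dist_subdivision, distFromOriginal,
        distFromSubdivision, h₁, h₂, eq_comm (a := a)]
  rw [mcount_bipartiteSubdivision, hset, Set.ncard_coe_finset]
  simp [Finset.card_compl]
  ring

end

/-- Let `m ≥ 3` and let `S` be the subdivision graph of `K_{m,m}`. For every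
edge `f = xy` of `S` with `x` an original vertex and `y` a subdivision vertex,
`m_x(f) = m² - 1` and `m_y(f) = 2m - 1`. -/
theorem subdivision_completeBipartite_mcount (m : ℕ) (hm : 3 ≤ m)
    (x : Fin m ⊕ Fin m) (y : (completeBipartiteGraph (Fin m) (Fin m)).edgeSet)
    (hadj : (subdivision (completeBipartiteGraph (Fin m) (Fin m))).Adj (Sum.inl x) (Sum.inr y)) :
    mcount (subdivision (completeBipartiteGraph (Fin m) (Fin m))) (Sum.inl x) (Sum.inr y)
        = m ^ 2 - 1 ∧
    mcount (subdivision (completeBipartiteGraph (Fin m) (Fin m))) (Sum.inr y) (Sum.inl x)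
        = 2 * m - 1 := by
  obtain ⟨p, rfl⟩ := (prodEquivEdgeSet (Fin m) (Fin m)).surjective y
  let φ := bipartiteSubdivisionIso (Fin m) (Fin m)
  let σ := bipartiteSubdivisionSwap (Fin m) (Fin m)
  have hx : φ (.inl x) = .inl x := rfl
  have hp : φ (.inr p) = .inr (prodEquivEdgeSet (Fin m) (Fin m) p) := rfl
  rw [← hx, ← hp, φ.map_adj_iff] at hadj
  rw [← hx, ← hp, mcount_map_iso, mcount_map_iso]
  have hsq : (m + 1) * (m - 1) = m ^ 2 - 1 := by
    simpa using (Nat.sq_sub_sq m 1).symm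
  obtain ⟨a, b⟩ := p
  rcases x with c | c
  · obtain rfl : c = a := hadj
    rw [mcount_original_subdivision, mcount_subdivision_original, Fintype.card_fin]
    exact ⟨hsq, by omega⟩
  · obtain rfl : c = b := hadj
    have hc : σ (.inl (.inl c)) = .inl (.inr c) := rfl
    have hac : σ (.inr (c, a)) = .inr (a, c) := rfl
    rw [← hc, ← hac, mcount_map_iso, mcount_map_iso, mcount_original_subdivision, mcount_subdivision_original, Fintype.card_fin]
    exact ⟨hsq, by omega⟩
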